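/- Let H be an infinite-dimensional separable complex Hilbert space. Then the unitary group U(H), consisting of all unitary continuous linear operators on H and equipped with the operator-norm topology, is contractible. -/

import Mathlib

namespace Kuiper

section Algebra

variable {R : Type*} [Ring R] (M : Submonoid R)

/-- A corner pair: two orthogonal isometries of a ring, given with their left inverses. -/
structure IsometryPair (a a' b b' : R) : Prop where
  left : a' * a = 1
  right : b' * b = 1
  left_right : a' * b = 0
  right_left : b' * a = 0

variable {M}

theorem mul_inv_mem_of_shear_mem (hM : ∀ n : R, n * n = 0 → 1 + n ∈ M) {c c' d d' w v : R}
    (h : IsometryPair c c' d d') (hwv : w * v = 1) (hvw : v * w = 1) :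
    1 - c * c' - d * d' + c * w * c' + d * v * d' ∈ M := by
  obtain ⟨h1, h2, h3, h4⟩ := h
  have r1 (x : R) : c' * (c * x) = x := by rw [← mul_assoc, h1, one_mul]
  have r2 (x : R) : d' * (d * x) = x := by rw [← mul_assoc, h2, one_mul]
  have r3 (x : R) : c' * (d * x) = 0 := by rw [← mul_assoc, h3, zero_mul]
  have r4 (x : R) : d' * (c * x) = 0 := by rw [← mul_assoc, h4, zero_mul]
  have r5 (x : R) : w * (v * x) = x := by rw [← mul_assoc, hwv, one_mul]
  have r6 (x : R) : v * (w * x) = x := by rw [← mul_assoc, hvw, one_mul]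
  have upper (x : R) : 1 + c * x * d' ∈ M := hM _ (by simp only [mul_assoc, r4, mul_zero])
  have lower (x : R) : 1 + d * x * c' ∈ M := hM _ (by simp only [mul_assoc, r3, mul_zero])
  have key : 1 - c * c' - d * d' + c * w * c' + d * v * d' =
      (1 + c * w * d') * (1 + d * (-v) * c') * (1 + c * w * d') *
        ((1 + c * (-1) * d') * (1 + d * 1 * c') * (1 + c * (-1) * d')) := by
    simp only [mul_add, add_mul, mul_assoc, mul_one, one_mul, neg_mul, mul_neg, mul_zero,
      r1, r2, r3, r4, r5, r6]
    noncomm_ring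
  rw [key]
  exact M.mul_mem (M.mul_mem (M.mul_mem (upper _) (lower _)) (upper _))
    (M.mul_mem (M.mul_mem (upper _) (lower _)) (upper _))

/-- The Eilenberg swindle. -/
theorem swindle_mem (hM : ∀ n : R, n * n = 0 → 1 + n ∈ M)
    (hcancel : ∀ m g : R, m ∈ M → m * g ∈ M → g ∈ M)
    {a a' b b' s s' t t' u D E : R} (h : IsometryPair a a' b b') (hab : a * a' + b * b' = 1)
    (hs : IsometryPair s s' t t') (hst : s * s' + t * t' = 1)
    (hDE : D * E = 1) (hED : E * D = 1) (hD : D = s * u * s' + t * D * t') :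
    a * u * a' + b * b' ∈ M := by
  obtain ⟨h1, h2, h3, h4⟩ := h
  obtain ⟨k1, k2, k3, k4⟩ := hs
  have r1 (x : R) : a' * (a * x) = x := by rw [← mul_assoc, h1, one_mul]
  have r2 (x : R) : b' * (b * x) = x := by rw [← mul_assoc, h2, one_mul]
  have r3 (x : R) : a' * (b * x) = 0 := by rw [← mul_assoc, h3, zero_mul]
  have r4 (x : R) : b' * (a * x) = 0 := by rw [← mul_assoc, h4, zero_mul]
  have q1 (x : R) : s' * (s * x) = x := by rw [← mul_assoc, k1, one_mul]
  have q2 (x : R) : t' * (t * x) = x := by rw [← mul_assoc, k2, one_mul]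
  have q3 (x : R) : s' * (t * x) = 0 := by rw [← mul_assoc, k3, zero_mul]
  have q4 (x : R) : t' * (s * x) = 0 := by rw [← mul_assoc, k4, zero_mul]
  have hbb : b * s * (s' * b') + b * t * (t' * b') = b * b' := by
    calc _ = b * (s * s' + t * t') * b' := by noncomm_ring
      _ = _ := by rw [hst, mul_one]
  have haa : 1 - b * s * (s' * b') - b * t * (t' * b') = a * a' := by
    rw [sub_sub, hbb, ← hab, add_sub_cancel_right]
  have e1 : a * a' + b * s * D * (s' * b') + b * t * E * (t' * b') ∈ M := by
    have := mul_inv_mem_of_shear_mem hM (c := b * s) (c' := s' * b') (d := b * t)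
      (d' := t' * b') ⟨by simp only [mul_assoc, r2, k1], by simp only [mul_assoc, r2, k2],
        by simp only [mul_assoc, r2, k3], by simp only [mul_assoc, r2, k4]⟩ hDE hED
    rwa [haa] at this
  have e2 : a * u * a' + b * s * D * (s' * b') + b * t * E * (t' * b') ∈ M := by
    have := mul_inv_mem_of_shear_mem hM (c := a * s' + b * s * t') (c' := s * a' + t * s' * b')
      (d := b * t) (d' := t' * b')
      ⟨by simp only [mul_add, add_mul, mul_assoc, r1, r2, r3, r4, q1, mul_zero,
            add_zero, zero_add, hst],
        by simp only [mul_assoc, r2, k2],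
        by simp only [add_mul, mul_assoc, r2, r3, k3, mul_zero, add_zero],
        by simp only [mul_add, mul_assoc, r2, r4, q4, mul_zero, add_zero]⟩ hDE hED
    have c1 : (a * s' + b * s * t') * (s * a' + t * s' * b') = 1 - b * t * (t' * b') := by
      rw [eq_sub_iff_add_eq]
      calc _ = a * a' + (b * s * (s' * b') + b * t * (t' * b')) := by
            simp only [mul_add, add_mul, mul_assoc, q1, q2, q3, q4, mul_zero, add_zero, zero_add,
              add_assoc]
        _ = 1 := by rw [hbb, hab]
    have c2 : (a * s' + b * s * t') * D * (s * a' + t * s' * b') =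
        a * u * a' + b * s * D * (s' * b') := by
      have d1 : s' * D = u * s' := by
        rw [hD]; simp only [mul_add, mul_assoc, q1, q3, add_zero]
      have d2 : t' * D = D * t' := by
        conv_lhs => rw [hD]
        simp only [mul_add, mul_assoc, q2, q4, zero_add]
      calc _ = (a * (s' * D) + b * s * (t' * D)) * (s * a' + t * s' * b') := by noncomm_ring
        _ = _ := by
          rw [d1, d2]
          simp only [mul_add, add_mul, mul_assoc, q1, q2, q3, q4, mul_zero, add_zero, zero_add]
    rw [c1, c2] at this
    convert this using 1
    abel
  refine hcancel _ _ e1 ?_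
  convert e2 using 1
  simp only [mul_add, add_mul, mul_assoc, r1, r2, r3, r4, mul_zero, add_zero, zero_add,
    add_assoc]

theorem mem_of_mul_isometry_eq (hM : ∀ n : R, n * n = 0 → 1 + n ∈ M)
    (hcancel : ∀ m g : R, m ∈ M → m * g ∈ M → g ∈ M)
    {s s' t t' : R} (hs : IsometryPair s s' t t') (hst : s * s' + t * t' = 1)
    (Δ : R →+* R) (hΔ : ∀ x, Δ x = s * x * s' + t * Δ x * t')
    {v v' g h : R} (hv : v' * v = 1) (hgh : g * h = 1) (hhg : h * g = 1) (hgv : g * v = v) :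
    g ∈ M := by
  obtain ⟨p, hp⟩ : ∃ p, p = v * v' := ⟨_, rfl⟩
  obtain ⟨q, hq⟩ : ∃ q, q = 1 - p := ⟨_, rfl⟩
  have hvx (x : R) : v' * (v * x) = x := by rw [← mul_assoc, hv, one_mul]
  have hpp : p * p = p := by simp only [hp, mul_assoc, hvx]
  have hqq : q * q = q := by simp only [hq, mul_sub, sub_mul, hpp, mul_one, one_mul]; abel
  have hpq : p * q = 0 := by simp only [hq, mul_sub, hpp, mul_one, sub_self]
  have hqp : q * p = 0 := by simp only [hq, sub_mul, hpp, one_mul, sub_self]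
  have hqv : q * v = 0 := by simp only [hq, hp, sub_mul, mul_assoc, hv, mul_one, one_mul, sub_self]
  have hvq : v' * q = 0 := by simp only [hq, hp, mul_sub, hvx, mul_one, sub_self]
  have hhv : h * v = v := by rw [← hgv, ← mul_assoc, hhg, one_mul, hgv]
  have hsum : p + q = 1 := by rw [hq]; abel
  have hgp : g * p = p := by rw [hp, ← mul_assoc, hgv]
  have hhp : h * p = p := by rw [hp, ← mul_assoc, hhv]
  have key (x y : R) (hy : y * p = p) (hx : x * y = 1) (hxp : x * p = p) :
      (p + q * x * q) * (p + q * y * q) = 1 := by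
    have h1 : q * x * q * (q * y * q) = q := by
      calc q * x * q * (q * y * q) = q * x * (q * q) * y * q := by noncomm_ring
        _ = q * (x * y) * q - q * (x * p) * y * q := by rw [hqq, hq]; noncomm_ring
        _ = q := by rw [hx, hxp, hqp, mul_one, hqq, zero_mul, zero_mul, sub_zero]
    calc _ = p * p + p * q * y * q + q * x * (q * p) + q * x * q * (q * y * q) := by
          noncomm_ring
      _ = 1 := by rw [hpp, hpq, hqp, h1, zero_mul, zero_mul, mul_zero, add_zero, add_zero, hsum]
  have hg : g = (p + q * g * q) * (1 + p * g * q) := by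
    calc g = g * p + (p + q) * g * q := by rw [hsum, hq]; noncomm_ring
      _ = p + q * g * q + p * p * g * q + q * g * (q * p) * g * q := by
        rw [hgp, hpp, hqp]; noncomm_ring
      _ = _ := by noncomm_ring
  rw [hg]
  refine M.mul_mem ?_ (hM _ (by
    calc p * g * q * (p * g * q) = p * g * (q * p) * g * q := by noncomm_ring
      _ = 0 := by rw [hqp]; noncomm_ring))
  have := swindle_mem (a := q + v * s * v') (a' := q + v * s' * v') (b := v * t)
    (b' := t' * v') (u := p + q * g * q) (D := Δ (p + q * g * q)) (E := Δ (p + q * h * q))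
    hM hcancel ?_ ?_ hs hst (by rw [← map_mul, key g h hhp hgh hgp, map_one])
    (by rw [← map_mul, key h g hgp hhg hhp, map_one]) (hΔ _)
  · convert this using 1
    have c1 : (q + v * s * v') * (p + q * g * q) = q * g * q + v * s * v' := by
      calc _ = q * p + q * q * g * q + v * s * (v' * v) * v' + v * s * (v' * q) * g * q := by
            rw [hp]; noncomm_ring
        _ = _ := by rw [hqp, hqq, hv, hvq]; noncomm_ring
    rw [c1]
    calc p + q * g * q = q * g * (q * q) + v * (s * s' + t * t') * v' := by
          rw [hqq, hst, hp]; noncomm_ring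
      _ = q * g * (q * q) + q * g * (q * v) * s' * v' + v * s * (v' * q) +
            v * s * (v' * v) * s' * v' + v * t * t' * v' := by
          rw [hqv, hvq, hv]; noncomm_ring
      _ = _ := by noncomm_ring
  · obtain ⟨k1, k2, k3, k4⟩ := hs
    refine ⟨?_, ?_, ?_, ?_⟩
    · calc _ = q * q + q * v * s * v' + v * s' * (v' * q) + v * s' * (v' * v) * s * v' := by
            noncomm_ring
        _ = q + v * (s' * s) * v' := by rw [hqq, hqv, hvq, hv]; noncomm_ring
        _ = 1 := by rw [k1, mul_one, ← hp, add_comm, hsum]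
    · rw [mul_assoc, hvx, k2]
    · calc _ = q * v * t + v * s' * (v' * v) * t := by noncomm_ring
        _ = v * (s' * t) := by rw [hqv, hv]; noncomm_ring
        _ = 0 := by rw [k3, mul_zero]
    · calc _ = t' * (v' * q) + t' * (v' * v) * s * v' := by noncomm_ring
        _ = t' * s * v' := by rw [hvq, hv]; noncomm_ring
        _ = 0 := by rw [k4, zero_mul]
  · calc _ = q * q + q * v * s' * v' + v * s * (v' * q) + v * s * (v' * v) * s' * v'
          + v * t * t' * v' := by noncomm_ring
      _ = q + v * (s * s' + t * t') * v' := by rw [hqq, hqv, hvq, hv]; noncomm_ring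
      _ = 1 := by rw [hst, mul_one, ← hp, add_comm, hsum]

theorem mem_of_corner_eq_zero (hM : ∀ n : R, n * n = 0 → 1 + n ∈ M)
    (hcancel : ∀ m g : R, m ∈ M → m * g ∈ M → g ∈ M)
    {s s' t t' : R} (hs : IsometryPair s s' t t') (hst : s * s' + t * t' = 1)
    (Δ : R →+* R) (hΔ : ∀ x, Δ x = s * x * s' + t * Δ x * t')
    (hunit : ∀ m ∈ M, IsUnit m)
    {v v' r r' g h : R} (hv : IsometryPair v v' r r') (hgh : g * h = 1) (hhg : h * g = 1)
    (hrgv : r' * g * v = 0) : g ∈ M := by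
  have hvr := hv
  obtain ⟨h1, h2, h3, h4⟩ := hv
  set L := v' * h * (1 - r * r') with hL
  have hLr : L * r = 0 := by
    calc L * r = v' * h * (r - r * (r' * r)) := by rw [hL]; noncomm_ring
      _ = 0 := by rw [h2]; noncomm_ring
  have hLgv : L * g * v = 1 := by
    calc L * g * v = v' * (h * g) * v - v' * h * r * (r' * g * v) := by rw [hL]; noncomm_ring
      _ = 1 := by rw [hhg, hrgv, mul_one, h1, mul_zero, sub_zero]
  have m1 : 1 + r * L ∈ M := hM _ (by
    calc _ = r * (L * r) * L := by noncomm_ring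
      _ = 0 := by rw [hLr]; noncomm_ring)
  have m2 : 1 + -(g * v * r') ∈ M := hM _ (by
    calc _ = g * v * (r' * g * v) * r' := by noncomm_ring
      _ = 0 := by rw [hrgv]; noncomm_ring)
  have m3 : 1 + v * r' ∈ M := hM _ (by
    calc _ = v * (r' * v) * r' := by noncomm_ring
      _ = 0 := by rw [h4]; noncomm_ring)
  have m4 : 1 + -(r * v') ∈ M := hM _ (by
    calc _ = r * (v' * r) * v' := by noncomm_ring
      _ = 0 := by rw [h3]; noncomm_ring)
  have m := M.mul_mem m4 (M.mul_mem m3 (M.mul_mem m2 m1))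
  refine hcancel _ _ m ?_
  obtain ⟨⟨x, y, hxy, hyx⟩, hu⟩ := (hunit _ m).mul ⟨⟨g, h, hgh, hhg⟩, rfl⟩
  simp only at hu
  rw [← hu]
  refine mem_of_mul_isometry_eq hM hcancel hs hst Δ hΔ h1 hxy hyx ?_
  rw [hu]
  have c1 : (1 + r * L) * (g * v) = g * v + r := by
    calc _ = g * v + r * (L * g * v) := by noncomm_ring
      _ = _ := by rw [hLgv, mul_one]
  have c2 : (1 + -(g * v * r')) * (g * v + r) = r := by
    calc _ = g * v + r - g * v * (r' * g * v) - g * v * (r' * r) := by noncomm_ring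
      _ = _ := by rw [hrgv, h2]; noncomm_ring
  have c3 : (1 + v * r') * r = r + v := by
    calc _ = r + v * (r' * r) := by noncomm_ring
      _ = _ := by rw [h2, mul_one]
  have c4 : (1 + -(r * v')) * (r + v) = v := by
    calc _ = r + v - r * (v' * r) - r * (v' * v) := by noncomm_ring
      _ = _ := by rw [h3, h1]; noncomm_ring
  simp only [mul_assoc] at c1 c2 c3 c4 ⊢
  rw [c1, c2, c3, c4]

end Algebra

section Units

variable {R : Type*} [NormedRing R] [NormedAlgebra ℝ R]

theorem shear_mem_of_isOpen {T : Subgroup Rˣ} (hT : IsOpen (T : Set Rˣ)) {n : R}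
    (hn : n * n = 0) : 1 + n ∈ T.toSubmonoid.map (Units.coeHom R) := by
  have h (t : ℝ) : (1 + t • n) * (1 - t • n) = 1 := by
    simp [mul_sub, add_mul, hn]
  have h' (t : ℝ) : (1 - t • n) * (1 + t • n) = 1 := by
    simp [mul_add, sub_mul, hn]
  let γ : ℝ → Rˣ := fun t => ⟨1 + t • n, 1 - t • n, h t, h' t⟩
  have hγ : Continuous γ := Units.continuous_iff.2
    ⟨by change Continuous fun t : ℝ => 1 + t • n; fun_prop,
      by change Continuous fun t : ℝ => 1 - t • n; fun_prop⟩
  have hclopen : IsClopen (γ ⁻¹' T) :=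
    ⟨(T.isClosed_of_isOpen hT).preimage hγ, hT.preimage hγ⟩
  have h0 : (0 : ℝ) ∈ γ ⁻¹' T := by
    have : γ 0 = 1 := Units.ext (by simp [γ])
    simp [this]
  have h1 : (1 : ℝ) ∈ γ ⁻¹' T := by
    rw [hclopen.eq_univ ⟨0, h0⟩]; trivial
  exact ⟨γ 1, h1, by simp [γ]⟩

theorem eq_top_of_isOpen [CompleteSpace R] {T : Subgroup Rˣ} (hT : IsOpen (T : Set Rˣ))
    {s s' t t' : R} (hs : IsometryPair s s' t t') (hst : s * s' + t * t' = 1)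
    (Δ : R →+* R) (hΔ : ∀ x, Δ x = s * x * s' + t * Δ x * t')
    (hR : ∀ g : R, ∀ δ > 0, ∃ v v' r r' : R, IsometryPair v v' r r' ∧
      ‖r * r' * g * v * v'‖ < δ) : T = ⊤ := by
  refine (Subgroup.eq_top_iff' T).2 fun g => ?_
  have hopen : IsOpen (Units.val '' {u : Rˣ | u * g⁻¹ ∈ T}) :=
    Units.isOpenEmbedding_val.isOpenMap _ (hT.preimage (continuous_mul_const _))
  obtain ⟨δ, hδ, hball⟩ := Metric.isOpen_iff.1 hopen (g : R) ⟨g, by simp [T.one_mem], rfl⟩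
  obtain ⟨v, v', r, r', hv, hlt⟩ := hR g δ hδ
  obtain ⟨u, hu, hug⟩ : (g : R) - r * r' * g * v * v' ∈ Units.val '' {u : Rˣ | u * g⁻¹ ∈ T} :=
    hball (by simpa [dist_eq_norm] using hlt)
  have hmem : (u : R) ∈ T.toSubmonoid.map (Units.coeHom R) := by
    refine mem_of_corner_eq_zero (fun n hn => shear_mem_of_isOpen hT hn) ?_ hs hst Δ hΔ ?_ hv
      u.mul_inv u.inv_mul ?_
    · rintro _ x ⟨m, hm, rfl⟩ ⟨y, hy, hyx⟩
      refine ⟨m⁻¹ * y, T.mul_mem (T.inv_mem hm) hy, ?_⟩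
      simp only [Units.coeHom_apply] at hyx
      simp [hyx]
    · rintro _ ⟨m, -, rfl⟩
      exact m.isUnit
    · rw [hug]
      calc _ = r' * g * v - (r' * r) * r' * g * v * (v' * v) := by noncomm_ring
        _ = 0 := by rw [hv.right, hv.left]; noncomm_ring
  obtain ⟨u', hu', huu⟩ := hmem
  obtain rfl : u' = u := Units.ext huu
  have := T.mul_mem (T.inv_mem hu) hu'
  simpa using this

end Units

section Hilbert

open scoped InnerProductSpace

variable {H : Type*} [NormedAddCommGroup H] [InnerProductSpace ℂ H]

theorem countable_of_orthonormal [TopologicalSpace.SeparableSpace H] {ι : Type*} {v : ι → H}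
    (hv : Orthonormal ℂ v) : Countable ι := by
  have hdist {i j : ι} (hij : i ≠ j) : 1 ≤ dist (v i) (v j) := by
    have h : ‖v i - v j‖ ^ 2 = 2 := by
      have := @norm_sub_sq ℂ H _ _ _ (v i) (v j)
      rw [hv.1 i, hv.1 j, hv.2 hij] at this
      norm_num at this
      exact this
    rw [dist_eq_norm]
    nlinarith [norm_nonneg (v i - v j)]
  have : (Set.univ : Set ι).PairwiseDisjoint fun i => Metric.ball (v i) (1 / 2) := by
    intro i _ j _ hij
    exact Metric.ball_disjoint_ball (by linarith [hdist hij])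
  exact Set.countable_univ_iff.1 (this.countable_of_isOpen (fun _ _ => Metric.isOpen_ball)
    fun i _ => ⟨v i, Metric.mem_ball_self (by norm_num)⟩)

theorem exists_unit_orthogonal [CompleteSpace H] (hH : ¬ FiniteDimensional ℂ H) {F : Set H}
    (hF : F.Finite) : ∃ x : H, ‖x‖ = 1 ∧ ∀ y ∈ F, ⟪y, x⟫_ℂ = 0 := by
  have := FiniteDimensional.span_of_finite ℂ hF
  have hne : (Submodule.span ℂ F)ᗮ ≠ ⊥ := by
    rw [Ne, Submodule.orthogonal_eq_bot_iff]
    intro htop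
    exact hH (Module.finite_def.2 (htop ▸ Submodule.fg_span hF))
  obtain ⟨x, hx, hx0⟩ := Submodule.exists_mem_ne_zero_of_ne_bot hne
  refine ⟨((‖x‖⁻¹ : ℝ) : ℂ) • x, ?_, fun y hy => ?_⟩
  · rw [norm_smul]; simp [norm_ne_zero_iff.2 hx0]
  · rw [inner_smul_right, (Submodule.mem_orthogonal _ _).1 hx y (Submodule.subset_span hy),
      mul_zero]

theorem eq_zero_of_inner_basis (b : HilbertBasis ℕ ℂ H) {S : H →L[ℂ] H}
    (h : ∀ n m, ⟪b n, S (b m)⟫_ℂ = 0) : S = 0 := by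
  refine ContinuousLinearMap.ext_on
    (Submodule.dense_iff_topologicalClosure_eq_top.2 b.dense_span) ?_
  rintro _ ⟨m, rfl⟩
  refine b.repr.injective (lp.ext (funext fun n => ?_))
  simp [b.repr_apply_apply, h]

variable [CompleteSpace H]

theorem exists_hilbertBasis_nat [TopologicalSpace.SeparableSpace H]
    (hH : ¬ FiniteDimensional ℂ H) : Nonempty (HilbertBasis ℕ ℂ H) := by
  obtain ⟨w, b, hb⟩ := exists_hilbertBasis ℂ H
  have := countable_of_orthonormal b.orthonormal
  have : Infinite w := by
    by_contra hfin
    rw [not_infinite_iff_finite] at hfin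
    have := Fintype.ofFinite w
    exact hH b.toOrthonormalBasis.toBasis.finiteDimensional_of_finite
  obtain ⟨e⟩ := nonempty_equiv_of_countable (α := ℕ) (β := w)
  refine ⟨HilbertBasis.mk (b.orthonormal.comp e e.injective) ?_⟩
  rw [e.surjective.range_comp, b.dense_span]

theorem exists_isometry_of_orthonormal (b : HilbertBasis ℕ ℂ H) {w : ℕ → H}
    (hw : Orthonormal ℂ w) : ∃ V : H →ₗᵢ[ℂ] H, ∀ n, V (b n) = w n := by
  refine ⟨hw.orthogonalFamily.linearIsometry.comp b.repr.toLinearIsometry, fun n => ?_⟩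
  simp [b.repr_self, OrthogonalFamily.linearIsometry_apply_single]

/-- Two sequences moved to mutually orthogonal positions by finitely many operators. -/
theorem exists_orthonormal_pair (hH : ¬ FiniteDimensional ℂ H) (𝒯 : Finset (H →L[ℂ] H)) :
    ∃ v r : ℕ → H, Orthonormal ℂ v ∧ Orthonormal ℂ r ∧ (∀ m n, ⟪r m, v n⟫_ℂ = 0) ∧
      ∀ T ∈ 𝒯, ∀ m n, ⟪r m, T (v n)⟫_ℂ = 0 := by
  classical
  obtain ⟨f, hP, hr⟩ := exists_seq_of_forall_finset_exists
    (fun p : H × H => ‖p.1‖ = 1 ∧ ‖p.2‖ = 1 ∧ ∀ T ∈ insert 1 𝒯, ⟪p.2, T p.1⟫_ℂ = 0)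
    (fun p q : H × H => ⟪p.1, q.1⟫_ℂ = 0 ∧ ⟪p.2, q.2⟫_ℂ = 0 ∧
      ∀ T ∈ insert 1 𝒯, ⟪p.2, T q.1⟫_ℂ = 0 ∧ ⟪q.2, T p.1⟫_ℂ = 0) (by
    intro s _
    obtain ⟨x, hx, hxF⟩ := exists_unit_orthogonal hH
      (F := (s.image Prod.fst ∪ (s ×ˢ insert 1 𝒯).image
        fun a : (H × H) × (H →L[ℂ] H) => a.2.adjoint a.1.2 : Finset H)) (Finset.finite_toSet _)
    obtain ⟨y, hy, hyF⟩ := exists_unit_orthogonal hH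
      (F := (s.image Prod.snd ∪ (insert 1 𝒯).image (fun T => T x) ∪ (s ×ˢ insert 1 𝒯).image
        fun a : (H × H) × (H →L[ℂ] H) => a.2 a.1.1 : Finset H)) (Finset.finite_toSet _)
    simp only [Finset.mem_coe, Finset.mem_union, Finset.mem_image, Finset.mem_product] at hxF hyF
    refine ⟨(x, y), ⟨hx, hy, fun T hT => ?_⟩, fun p hp => ⟨?_, ?_, fun T hT => ⟨?_, ?_⟩⟩⟩
    · exact inner_eq_zero_symm.1 (hyF _ (Or.inl (Or.inr ⟨T, hT, rfl⟩)))
    · exact hxF _ (Or.inl ⟨p, hp, rfl⟩)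
    · exact hyF _ (Or.inl (Or.inl ⟨p, hp, rfl⟩))
    · rw [← ContinuousLinearMap.adjoint_inner_left]
      exact hxF _ (Or.inr ⟨(p, T), ⟨hp, hT⟩, rfl⟩)
    · exact inner_eq_zero_symm.1 (hyF _ (Or.inr ⟨(p, T), ⟨hp, hT⟩, rfl⟩)))
  have hall (T) (hT : T ∈ insert 1 𝒯) (m n : ℕ) : ⟪(f m).2, T (f n).1⟫_ℂ = 0 := by
    rcases lt_trichotomy m n with h | rfl | h
    · exact ((hr _ _ h).2.2 T hT).1
    · exact (hP m).2.2 T hT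
    · exact ((hr _ _ h).2.2 T hT).2
  refine ⟨fun n => (f n).1, fun n => (f n).2, ⟨fun n => (hP n).1, ?_⟩, ⟨fun n => (hP n).2.1, ?_⟩,
    fun m n => hall 1 (Finset.mem_insert_self _ _) m n,
    fun T hT => hall T (Finset.mem_insert_of_mem hT)⟩
  · intro m n hmn
    rcases lt_or_gt_of_ne hmn with h | h
    · exact (hr _ _ h).1
    · exact inner_eq_zero_symm.1 (hr _ _ h).1
  · intro m n hmn
    rcases lt_or_gt_of_ne hmn with h | h
    · exact (hr _ _ h).2.1
    · exact inner_eq_zero_symm.1 (hr _ _ h).2.1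

theorem adjoint_mul_self_of_isometry (V : H →ₗᵢ[ℂ] H) :
    V.toContinuousLinearMap.adjoint * V.toContinuousLinearMap = 1 :=
  (ContinuousLinearMap.norm_map_iff_adjoint_comp_self _).1 V.norm_map

theorem exists_isometryPair [TopologicalSpace.SeparableSpace H] (hH : ¬ FiniteDimensional ℂ H)
    (𝒯 : Finset (H →L[ℂ] H)) : ∃ v v' r r' : H →L[ℂ] H, IsometryPair v v' r r' ∧
      (∀ T ∈ 𝒯, r' * T * v = 0) ∧ ‖v‖ ≤ 1 ∧ ‖v'‖ ≤ 1 ∧ ‖r‖ ≤ 1 ∧ ‖r'‖ ≤ 1 := by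
  obtain ⟨b⟩ := exists_hilbertBasis_nat hH
  obtain ⟨v, r, hv, hr, hrv, hrT⟩ := exists_orthonormal_pair hH 𝒯
  obtain ⟨V, hV⟩ := exists_isometry_of_orthonormal b hv
  obtain ⟨R, hR⟩ := exists_isometry_of_orthonormal b hr
  refine ⟨V.toContinuousLinearMap, V.toContinuousLinearMap.adjoint, R.toContinuousLinearMap,
    R.toContinuousLinearMap.adjoint, ⟨adjoint_mul_self_of_isometry V,
      adjoint_mul_self_of_isometry R, eq_zero_of_inner_basis b fun n m => ?_,
      eq_zero_of_inner_basis b fun n m => ?_⟩, fun T hT => eq_zero_of_inner_basis b fun n m => ?_,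
      V.norm_toContinuousLinearMap_le, ?_, R.norm_toContinuousLinearMap_le, ?_⟩
  · simp [ContinuousLinearMap.adjoint_inner_right, hV, hR, inner_eq_zero_symm.1 (hrv _ _)]
  · simp [ContinuousLinearMap.adjoint_inner_right, hV, hR, hrv]
  · simp [ContinuousLinearMap.adjoint_inner_right, hV, hR, hrT T hT]
  · rw [LinearIsometryEquiv.norm_map]; exact V.norm_toContinuousLinearMap_le
  · rw [LinearIsometryEquiv.norm_map]; exact R.norm_toContinuousLinearMap_le

/-- A separable infinite-dimensional Hilbert space is the Hilbert sum of countably many copies of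
itself. -/
theorem exists_linearIsometryEquiv_lp [TopologicalSpace.SeparableSpace H]
    (hH : ¬ FiniteDimensional ℂ H) : Nonempty (H ≃ₗᵢ[ℂ] lp (fun _ : ℕ => H) 2) := by
  obtain ⟨b⟩ := exists_hilbertBasis_nat hH
  have hinj (k : ℕ) : Function.Injective fun n => Nat.pair k n := fun m n h => by
    simpa using h
  choose V hV using fun k => exists_isometry_of_orthonormal b (b.orthonormal.comp _ (hinj k))
  refine ⟨(IsHilbertSum.mk (V := V) ?_ ?_).linearIsometryEquiv⟩
  · intro k l hkl x y
    have : (V k).toContinuousLinearMap.adjoint * (V l).toContinuousLinearMap = 0 := by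
      refine eq_zero_of_inner_basis b fun n m => ?_
      simp only [mul_apply_eq_comp, ContinuousLinearMap.adjoint_inner_right,
        LinearIsometry.coe_toContinuousLinearMap, hV]
      exact b.orthonormal.2 (by simp [Nat.pair_eq_pair, hkl])
    have h := congrArg (fun S : H →L[ℂ] H => ⟪x, S y⟫_ℂ) this
    simpa [ContinuousLinearMap.adjoint_inner_right] using h
  · rw [← b.dense_span]
    refine Submodule.topologicalClosure_mono (Submodule.span_le.2 ?_)
    rintro _ ⟨n, rfl⟩
    refine Submodule.mem_iSup_of_mem n.unpair.1 ⟨b n.unpair.2, ?_⟩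
    simpa using hV n.unpair.1 n.unpair.2

end Hilbert

section Amplification

theorem summable_norm_sq {E : Type*} [NormedAddCommGroup E] (f : lp (fun _ : ℕ => E) 2) :
    Summable fun n => ‖f n‖ ^ 2 := by
  simpa using (lp.memℓp f).summable (by norm_num)

theorem norm_sq_eq_tsum {E : Type*} [NormedAddCommGroup E] (f : lp (fun _ : ℕ => E) 2) :
    ‖f‖ ^ 2 = ∑' n, ‖f n‖ ^ 2 := by
  simpa using lp.norm_rpow_eq_tsum (p := 2) (by norm_num) f

variable {H : Type*} [NormedAddCommGroup H] [InnerProductSpace ℂ H]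

/-- The diagonal operator on a countable Hilbert sum all of whose entries are `T`. -/
noncomputable def amplify (T : H →L[ℂ] H) :
    lp (fun _ : ℕ => H) 2 →L[ℂ] lp (fun _ : ℕ => H) 2 :=
  LinearMap.mkContinuous
    { toFun := fun f => ⟨fun n => T (f n), ((lp.memℓp f).norm.const_mul ‖T‖).mono
        fun n => by simpa using T.le_opNorm (f n)⟩
      map_add' := fun f g => lp.ext (funext fun n => T.map_add (f n) (g n))
      map_smul' := fun c f => lp.ext (funext fun n => T.map_smul c (f n)) } ‖T‖ fun f => by
    refine lp.norm_le_of_forall_sum_le (by norm_num) (by positivity) fun s => ?_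
    rw [Real.mul_rpow (norm_nonneg _) (norm_nonneg _)]
    refine le_trans ?_ (mul_le_mul_of_nonneg_left
      (lp.sum_rpow_le_norm_rpow (by norm_num) f s) (by positivity))
    rw [Finset.mul_sum]
    refine Finset.sum_le_sum fun n _ => ?_
    rw [← Real.mul_rpow (norm_nonneg _) (norm_nonneg _)]
    exact Real.rpow_le_rpow (norm_nonneg _) (T.le_opNorm _) (by norm_num)

@[simp]
theorem amplify_apply (T : H →L[ℂ] H) (f : lp (fun _ : ℕ => H) 2) (n : ℕ) :
    amplify T f n = T (f n) := rfl

theorem norm_amplify_le (T : H →L[ℂ] H) : ‖amplify T‖ ≤ ‖T‖ :=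
  LinearMap.mkContinuous_norm_le _ (norm_nonneg _) _

/-- The backward shift on a countable Hilbert sum. -/
noncomputable def backwardShift : lp (fun _ : ℕ => H) 2 →L[ℂ] lp (fun _ : ℕ => H) 2 :=
  LinearMap.mkContinuous
    { toFun := fun f => ⟨fun n => f (n + 1), memℓp_gen (by
        simpa using (summable_nat_add_iff 1).2 (summable_norm_sq f))⟩
      map_add' := fun _ _ => rfl
      map_smul' := fun _ _ => rfl } 1 fun f => by
    rw [one_mul, ← sq_le_sq₀ (norm_nonneg _) (norm_nonneg _), norm_sq_eq_tsum, norm_sq_eq_tsum,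
      (summable_norm_sq f).tsum_eq_zero_add]
    exact le_add_of_nonneg_left (by positivity)

@[simp]
theorem backwardShift_apply (f : lp (fun _ : ℕ => H) 2) (n : ℕ) :
    backwardShift f n = f (n + 1) := rfl

/-- The forward shift on a countable Hilbert sum. -/
noncomputable def forwardShift : lp (fun _ : ℕ => H) 2 →L[ℂ] lp (fun _ : ℕ => H) 2 :=
  LinearMap.mkContinuous
    { toFun := fun f => ⟨fun n => Nat.casesOn n 0 f, memℓp_gen (by
        simpa using (summable_nat_add_iff 1).1 (by simpa using summable_norm_sq f))⟩
      map_add' := fun f g => lp.ext (funext fun n => by cases n; exacts [(add_zero 0).symm, rfl])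
      map_smul' := fun c f => lp.ext (funext fun n => by
        cases n; exacts [(smul_zero c).symm, rfl]) } 1 fun f => by
    rw [one_mul, ← sq_le_sq₀ (norm_nonneg _) (norm_nonneg _), norm_sq_eq_tsum, norm_sq_eq_tsum,
      (summable_norm_sq _).tsum_eq_zero_add]
    simp

@[simp]
theorem forwardShift_zero (f : lp (fun _ : ℕ => H) 2) : forwardShift f 0 = 0 := rfl

@[simp]
theorem forwardShift_succ (f : lp (fun _ : ℕ => H) 2) (n : ℕ) :
    forwardShift f (n + 1) = f n := rfl

theorem exists_amplification [CompleteSpace H] [TopologicalSpace.SeparableSpace H]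
    (hH : ¬ FiniteDimensional ℂ H) :
    ∃ (s s' t t' : H →L[ℂ] H) (Δ : (H →L[ℂ] H) →+* (H →L[ℂ] H)), Continuous Δ ∧
      IsometryPair s s' t t' ∧ s * s' + t * t' = 1 ∧ ∀ x, Δ x = s * x * s' + t * Δ x * t' := by
  obtain ⟨e⟩ := exists_linearIsometryEquiv_lp hH
  let E : H →L[ℂ] lp (fun _ : ℕ => H) 2 := e.toContinuousLinearEquiv
  let F : lp (fun _ : ℕ => H) 2 →L[ℂ] H := e.symm.toContinuousLinearEquiv
  have hE (x) : E x = e x := rfl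
  have hF (x) : F x = e.symm x := rfl
  let Δ : (H →L[ℂ] H) →+* (H →L[ℂ] H) :=
    { toFun := fun T => F ∘L amplify T ∘L E
      map_one' := by
        ext x
        have : amplify 1 (E x) = E x := lp.ext (funext fun n => by simp)
        rw [hE] at this
        simp [this, hE, hF]
      map_zero' := by
        ext x
        have : amplify 0 (E x) = 0 := lp.ext (funext fun n => by simp)
        simp [this]
      map_mul' := fun S T => by
        ext x
        have : amplify (S * T) (E x) = amplify S (amplify T (E x)) :=
          lp.ext (funext fun n => by simp)
        rw [hE] at this
        simp [this, hE, hF]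
      map_add' := fun S T => by
        ext x
        have : amplify (S + T) (E x) = amplify S (E x) + amplify T (E x) :=
          lp.ext (funext fun n => by simp)
        rw [hE] at this
        simp [this, hE] }
  have hΔ (T) : Δ T = F ∘L amplify T ∘L E := rfl
  refine ⟨F ∘L lp.singleContinuousLinearMap ℂ (fun _ : ℕ => H) 2 0,
    lp.evalCLM ℂ (fun _ : ℕ => H) 2 0 ∘L E,
    F ∘L forwardShift ∘L E, F ∘L backwardShift ∘L E, Δ, ?_, ⟨?_, ?_, ?_, ?_⟩, ?_, ?_⟩
  · refine AddMonoidHomClass.continuous_of_bound Δ (‖F‖ * ‖E‖) fun T => ?_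
    calc ‖F ∘L amplify T ∘L E‖ ≤ ‖F‖ * (‖amplify T‖ * ‖E‖) :=
          (ContinuousLinearMap.opNorm_comp_le _ _).trans
            (mul_le_mul_of_nonneg_left (ContinuousLinearMap.opNorm_comp_le _ _) (norm_nonneg _))
      _ ≤ ‖F‖ * (‖T‖ * ‖E‖) := by gcongr; exact norm_amplify_le T
      _ = _ := by ring
  · ext x
    simp [hE, hF, lp.evalCLM]
  · ext x
    have : backwardShift (forwardShift (E x)) = E x := lp.ext (funext fun n => by simp)
    rw [hE] at this
    simp [hE, hF, this]
  · ext x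
    simp [hE, hF, lp.evalCLM]
  · ext x
    have : backwardShift (lp.single (E := fun _ : ℕ => H) 2 0 x) = 0 :=
      lp.ext (funext fun n => by simp [lp.single_apply])
    simp [hE, hF, this]
  · ext x
    have : lp.single 2 0 (E x 0) + forwardShift (backwardShift (E x)) = E x := by
      refine lp.ext (funext fun n => ?_)
      cases n <;> simp [lp.single_apply]
    rw [hE] at this
    simp [hE, hF, lp.evalCLM, ← map_add, this]
  · intro T
    ext x
    have : lp.single 2 0 (T (E x 0)) + forwardShift (amplify T (backwardShift (E x))) =
        amplify T (E x) := by
      refine lp.ext (funext fun n => ?_)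
      cases n <;> simp [lp.single_apply]
    rw [hE] at this
    simp [hΔ, hE, hF, lp.evalCLM, ← map_add, this]

end Amplification

section Tietze

variable {X E : Type*} [TopologicalSpace X] [CompactSpace X] [T2Space X]
  [NormedAddCommGroup E] [NormedSpace ℝ E]

theorem exists_dist_restrict_lt {K : Set X} (hK : IsClosed K) (f : C(K, E)) {C ε : ℝ}
    (hC : ∀ x, ‖f x‖ ≤ C) (hC0 : 0 ≤ C) (hε : 0 < ε) :
    ∃ g : C(X, E), (∀ x, ‖g x‖ ≤ C) ∧ ∀ x : K, ‖g x - f x‖ < ε := by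
  obtain ⟨g, hg⟩ := exists_continuous_forall_mem_convex_of_local_const
    (t := fun x : X => Metric.closedBall (0 : E) C ∩
      {e | ∀ h : x ∈ K, e ∈ Metric.ball (f ⟨x, h⟩) ε})
    (fun x => (convex_closedBall 0 C).inter (by
      by_cases h : x ∈ K
      · simpa only [h, forall_true_left, Set.ofPred_mem_eq] using convex_ball (f ⟨x, h⟩) ε
      · simp [h, convex_univ])) (fun x => by
      by_cases h : x ∈ K
      · refine ⟨f ⟨x, h⟩, ?_⟩
        have h1 : ∀ᶠ y in nhds (⟨x, h⟩ : K), f ⟨x, h⟩ ∈ Metric.ball (f y) ε := by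
          filter_upwards [f.continuous.continuousAt (Metric.ball_mem_nhds _ hε)] with y hy
          rwa [Metric.mem_ball_comm]
        rw [nhds_subtype_eq_comap, Filter.eventually_comap] at h1
        filter_upwards [h1] with y hy
        exact ⟨by simpa using hC ⟨x, h⟩, fun hyK => hy ⟨y, hyK⟩ rfl⟩
      · refine ⟨0, ?_⟩
        filter_upwards [hK.isOpen_compl.mem_nhds h] with y hy
        exact ⟨by simpa using hC0, fun hyK => (hy hyK).elim⟩)
  exact ⟨g, fun x => by simpa using (hg x).1,
    fun x => by simpa [dist_eq_norm] using (hg x).2 x.2⟩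

/-- A version of the Tietze extension theorem for maps with values in a Banach space. -/
theorem exists_restrict_eq_of_isClosed [CompleteSpace E] {K : Set X} (hK : IsClosed K)
    (f : C(K, E)) : ∃ g : C(X, E), g.restrict K = f := by
  have := isCompact_iff_compactSpace.1 hK.isCompact
  let ρ : NormedAddGroupHom C(X, E) C(K, E) :=
    { toFun := fun g => g.restrict K
      map_add' := fun _ _ => rfl
      bound' := ⟨1, fun g => by
        rw [one_mul, ContinuousMap.norm_le _ (norm_nonneg _)]
        exact fun x => g.norm_coe_le_norm x⟩ }
  have hρ (g : C(X, E)) (x : K) : ρ g x = g x := rfl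
  have hsurj : ρ.SurjectiveOnWith ρ.toAddMonoidHom.range 1 := by
    rintro f ⟨g, rfl : ρ g = f⟩
    rcases (norm_nonneg (ρ g)).eq_or_lt with h0 | h0
    · exact ⟨0, by rw [map_zero, eq_comm, ← norm_eq_zero, ← h0], by simp⟩
    have hm (x : X) : 0 < max ‖ρ g‖ ‖g x‖ := h0.trans_le (le_max_left _ _)
    refine ⟨⟨fun x => (‖ρ g‖ / max ‖ρ g‖ ‖g x‖) • g x, ?_⟩, ?_, ?_⟩
    · exact (continuous_const.div (by fun_prop) fun x => (hm x).ne').smul g.continuous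
    · ext1 x
      change (‖ρ g‖ / max ‖ρ g‖ ‖g x‖) • g x = g x
      rw [max_eq_left (hρ g x ▸ (ρ g).norm_coe_le_norm x), div_self h0.ne', one_smul]
    · rw [one_mul, ContinuousMap.norm_le _ h0.le]
      intro x
      change ‖(‖ρ g‖ / max ‖ρ g‖ ‖g x‖) • g x‖ ≤ _
      rw [norm_smul, Real.norm_of_nonneg (div_nonneg h0.le (hm x).le), div_mul_eq_mul_div,
        div_le_iff₀ (hm x)]
      gcongr
      exact le_max_right _ _
  obtain ⟨g, hg, -⟩ := controlled_closure_of_complete one_pos one_pos hsurj f <| by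
    refine Metric.mem_closure_iff.2 fun ε hε => ?_
    obtain ⟨g, -, hg⟩ := exists_dist_restrict_lt hK f f.norm_coe_le_norm (norm_nonneg f)
      (half_pos hε)
    refine ⟨ρ g, ⟨g, rfl⟩, lt_of_le_of_lt ?_ (half_lt_self hε)⟩
    rw [dist_comm, dist_eq_norm, ContinuousMap.norm_le _ (half_pos hε).le]
    exact fun x => (hg x).le
  exact ⟨g, hg⟩

end Tietze

section Mapping

variable {H : Type*} [NormedAddCommGroup H] [InnerProductSpace ℂ H] [CompleteSpace H]
  [TopologicalSpace.SeparableSpace H]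

theorem subgroup_units_continuousMap_eq_top (hH : ¬ FiniteDimensional ℂ H) {X : Type*}
    [TopologicalSpace X] [CompactSpace X] {T : Subgroup C(X, H →L[ℂ] H)ˣ}
    (hT : IsOpen (T : Set C(X, H →L[ℂ] H)ˣ)) : T = ⊤ := by
  obtain ⟨s, s', t, t', Δ, hΔc, ⟨h1, h2, h3, h4⟩, hst, hΔ⟩ := exists_amplification hH
  refine eq_top_of_isOpen hT (s := .const X s) (s' := .const X s') (t := .const X t)
    (t' := .const X t') ⟨?_, ?_, ?_, ?_⟩ ?_ (Δ.compLeftContinuous X hΔc) ?_ ?_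
  · ext1 x; exact h1
  · ext1 x; exact h2
  · ext1 x; exact h3
  · ext1 x; exact h4
  · ext1 x; exact hst
  · intro g; ext1 x; exact hΔ (g x)
  · intro g δ hδ
    obtain ⟨N, -, hN, hcov⟩ := (isCompact_range g.continuous).finite_cover_balls (half_pos hδ)
    obtain ⟨v, v', r, r', ⟨i1, i2, i3, i4⟩, hz, nv, nv', nr, nr'⟩ :=
      exists_isometryPair hH hN.toFinset
    refine ⟨.const X v, .const X v', .const X r, .const X r', ⟨?_, ?_, ?_, ?_⟩, ?_⟩
    · ext1 x; exact i1
    · ext1 x; exact i2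
    · ext1 x; exact i3
    · ext1 x; exact i4
    · refine lt_of_le_of_lt ((ContinuousMap.norm_le _ (half_pos hδ).le).2 fun x => ?_)
        (half_lt_self hδ)
      change ‖r * r' * g x * v * v'‖ ≤ _
      obtain ⟨A, hA, hx⟩ := Set.mem_iUnion₂.1 (hcov ⟨x, rfl⟩)
      have e : r * r' * g x * v * v' = r * r' * (g x - A) * v * v' := by
        have := hz A (by simpa using hA)
        rw [mul_sub, sub_mul, sub_mul]
        have : r * r' * A * v = 0 := by rw [mul_assoc, mul_assoc, ← mul_assoc r', this, mul_zero]
        simp [this]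
      rw [e]
      have hx' : ‖g x - A‖ ≤ δ / 2 := by simpa [dist_eq_norm] using (Metric.mem_ball.1 hx).le
      calc ‖r * r' * (g x - A) * v * v'‖ ≤ ‖r‖ * ‖r'‖ * ‖g x - A‖ * ‖v‖ * ‖v'‖ := by
            refine (norm_mul_le _ _).trans ?_
            gcongr
            refine (norm_mul_le _ _).trans ?_
            gcongr
            refine (norm_mul_le _ _).trans ?_
            gcongr
            exact norm_mul_le _ _
        _ ≤ 1 * 1 * (δ / 2) * 1 * 1 := by gcongr
        _ = _ := by ring

/-- A unit-valued map on a closed subset of a compact space extends to a unit-valued map. -/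
theorem exists_isUnit_restrict_eq (hH : ¬ FiniteDimensional ℂ H) {X : Type*} [TopologicalSpace X]
    [CompactSpace X] [T2Space X] {K : Set X} (hK : IsClosed K) (f : C(K, H →L[ℂ] H))
    (hf : ∀ x, IsUnit (f x)) :
    ∃ g : C(X, H →L[ℂ] H), (∀ x, IsUnit (g x)) ∧ g.restrict K = f := by
  have := isCompact_iff_compactSpace.1 hK.isCompact
  let ρ : C(X, H →L[ℂ] H) →+* C(K, H →L[ℂ] H) :=
    { toFun := fun g => g.restrict K
      map_add' := fun _ _ => rfl
      map_mul' := fun _ _ => rfl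
      map_one' := rfl
      map_zero' := rfl }
  have hρopen : IsOpenMap ρ := by
    let ρ' : C(X, H →L[ℂ] H) →L[ℝ] C(K, H →L[ℂ] H) :=
      LinearMap.mkContinuous { toFun := fun g => g.restrict K
                               map_add' := fun _ _ => rfl
                               map_smul' := fun _ _ => rfl } 1 fun g => by
        rw [one_mul, ContinuousMap.norm_le _ (norm_nonneg _)]
        exact fun x => g.norm_coe_le_norm x
    exact ρ'.isOpenMap (exists_restrict_eq_of_isClosed hK)
  have hT : IsOpen ((Units.map (ρ : C(X, H →L[ℂ] H) →* C(K, H →L[ℂ] H))).range :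
      Set C(K, H →L[ℂ] H)ˣ) := by
    have : ((Units.map (ρ : C(X, H →L[ℂ] H) →* C(K, H →L[ℂ] H))).range :
        Set C(K, H →L[ℂ] H)ˣ) = Units.val ⁻¹' (ρ '' {g | IsUnit g}) := by
      ext u
      constructor
      · rintro ⟨v, rfl⟩
        exact ⟨v, v.isUnit, rfl⟩
      · rintro ⟨_, ⟨v, rfl⟩, hv⟩
        exact ⟨v, Units.ext hv⟩
    rw [this]
    exact (hρopen _ Units.isOpen).preimage Units.continuous_val
  obtain ⟨u, hu⟩ := (ContinuousMap.isUnit_iff_forall_isUnit f).2 hf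
  obtain ⟨v, hv⟩ : u ∈ (Units.map (ρ : C(X, H →L[ℂ] H) →* C(K, H →L[ℂ] H))).range := by
    rw [subgroup_units_continuousMap_eq_top hH hT]
    trivial
  exact ⟨v, (ContinuousMap.isUnit_iff_forall_isUnit _).1 v.isUnit,
    (congrArg Units.val hv).trans hu⟩

open Classical in
theorem exists_continuousOn_isUnit_eqOn (hH : ¬ FiniteDimensional ℂ H) {Y : Type*}
    [TopologicalSpace Y] [T2Space Y] {D K : Set Y} (hD : IsCompact D) (hK : IsClosed K)
    (hKD : K ⊆ D) {f : Y → H →L[ℂ] H} (hfc : ContinuousOn f K) (hf : ∀ y ∈ K, IsUnit (f y)) :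
    ∃ F : Y → H →L[ℂ] H, ContinuousOn F D ∧ Set.EqOn F f K ∧ ∀ y ∈ D, IsUnit (F y) := by
  have := isCompact_iff_compactSpace.1 hD
  obtain ⟨g, hg, hgf⟩ := exists_isUnit_restrict_eq hH (X := D)
    (hK.preimage continuous_subtype_val)
    ⟨fun x => f x.1, hfc.comp_continuous (by fun_prop) fun x => x.2⟩ fun x => hf _ x.2
  refine ⟨fun y => if h : y ∈ D then g ⟨y, h⟩ else 0, ?_, ?_, ?_⟩
  · rw [continuousOn_iff_continuous_domRestrict]
    convert g.continuous
    ext1 x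
    simp
  · intro y hy
    simpa [hKD hy] using DFunLike.congr_fun hgf ⟨⟨y, hKD hy⟩, hy⟩
  · intro y hy
    simpa [hy] using hg ⟨y, hy⟩

end Mapping

section Nerve

variable {ι : Type*}

/-- The geometric simplex spanned by a finite set of vertices. -/
def simplex (s : Finset ι) : Set (ι → ℝ) :=
  {t | (∀ i, 0 ≤ t i) ∧ (∀ i ∉ s, t i = 0) ∧ ∑ i ∈ s, t i = 1}

theorem simplex_mono {s s' : Finset ι} (h : s ⊆ s') : simplex s ⊆ simplex s' :=
  fun t ⟨h0, hs, h1⟩ => ⟨h0, fun i hi => hs i fun his => hi (h his),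
    by rw [← Finset.sum_subset h fun i _ hi => hs i hi, h1]⟩

theorem mem_simplex_of_support {s s' : Finset ι} {t : ι → ℝ} (h : t ∈ simplex s)
    (hs' : ∀ i ∈ s, i ∉ s' → t i = 0) (hss : s' ⊆ s) : t ∈ simplex s' := by
  refine ⟨h.1, fun i hi => ?_, ?_⟩
  · by_cases his : i ∈ s
    · exact hs' i his hi
    · exact h.2.1 i his
  · rw [Finset.sum_subset hss hs', h.2.2]

theorem isCompact_simplex (s : Finset ι) : IsCompact (simplex s) := by
  refine (isCompact_univ_pi fun _ : ι => isCompact_Icc (a := (0 : ℝ)) (b := 1)).of_isClosed_subset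
    ?_ ?_
  · simp only [simplex, Set.ofPred_and, Set.ofPred_forall]
    refine (isClosed_iInter fun i => ?_).inter
      ((isClosed_iInter fun i => isClosed_iInter fun _ => ?_).inter ?_)
    · exact isClosed_le (by fun_prop) (by fun_prop)
    · exact isClosed_eq (by fun_prop) (by fun_prop)
    · exact isClosed_eq (by fun_prop) (by fun_prop)
  · rintro t ⟨h0, hs, h1⟩ i -
    refine ⟨h0 i, ?_⟩
    by_cases hi : i ∈ s
    · exact h1 ▸ Finset.single_le_sum (fun j _ => h0 j) hi
    · simp [hs i hi]

open Classical in
/-- The vertices of the open face containing `t` (or `∅` if `t` is not finitely supported). -/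
noncomputable def carrier (t : ι → ℝ) : Finset ι :=
  if h : t.support.Finite then h.toFinset else ∅

theorem mem_carrier {s : Finset ι} {t : ι → ℝ} (h : t ∈ simplex s) {i : ι} :
    i ∈ carrier t ↔ t i ≠ 0 := by
  have : t.support.Finite := s.finite_toSet.subset fun i hi => by
    by_contra his
    exact hi (h.2.1 i his)
  simp [carrier, this]

theorem carrier_subset {s : Finset ι} {t : ι → ℝ} (h : t ∈ simplex s) : carrier t ⊆ s := by
  intro i hi
  by_contra his
  exact (mem_carrier h).1 hi (h.2.1 i his)

theorem mem_simplex_carrier {s : Finset ι} {t : ι → ℝ} (h : t ∈ simplex s) :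
    t ∈ simplex (carrier t) :=
  mem_simplex_of_support h (fun _ _ hi => not_not.1 fun h0 => hi ((mem_carrier h).2 h0))
    (carrier_subset h)

section Ring

variable {A : Type*} [NormedRing A] [NormedAlgebra ℝ A] (b : ι → A)

/-- The affine map from the nerve sending the vertices to the points `b i`. -/
noncomputable def affineMap (t : ι → ℝ) : A := ∑ᶠ i, t i • b i

theorem affineMap_eq_sum {s : Finset ι} {t : ι → ℝ} (h : t ∈ simplex s) :
    affineMap b t = ∑ i ∈ s, t i • b i :=
  finsum_eq_sum_of_support_subset _ fun i hi => by
    by_contra his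
    exact hi (by simp [h.2.1 i his])

theorem continuousOn_affineMap (s : Finset ι) : ContinuousOn (affineMap b) (simplex s) := by
  have : Continuous fun t : ι → ℝ => ∑ i ∈ s, t i • b i := by fun_prop
  exact this.continuousOn.congr fun t ht => affineMap_eq_sum b ht

/-- `F` contracts the simplex `s`, mapped affinely by `b`, to `1` through units. -/
structure Contracts (F : (ι → ℝ) × ℝ → A) (s : Finset ι) : Prop where
  continuousOn : ContinuousOn F (simplex s ×ˢ Set.Icc 0 1)
  isUnit : ∀ y ∈ simplex s ×ˢ Set.Icc (0 : ℝ) 1, IsUnit (F y)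
  zero : ∀ t ∈ simplex s, F (t, 0) = affineMap b t
  one : ∀ t ∈ simplex s, F (t, 1) = 1

variable {b}

theorem Contracts.congr {F G : (ι → ℝ) × ℝ → A} {s : Finset ι} (h : Contracts b F s)
    (hFG : Set.EqOn G F (simplex s ×ˢ Set.Icc 0 1)) : Contracts b G s where
  continuousOn := h.continuousOn.congr hFG
  isUnit y hy := by rw [hFG hy]; exact h.isUnit y hy
  zero t ht := by rw [hFG ⟨ht, by simp⟩, h.zero t ht]
  one t ht := by rw [hFG ⟨ht, by simp⟩, h.one t ht]

end Ring

variable {H : Type*} [NormedAddCommGroup H] [InnerProductSpace ℂ H] [CompleteSpace H]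
  [TopologicalSpace.SeparableSpace H] {b : ι → H →L[ℂ] H}

open Classical in
theorem Contracts.exists_extend_boundary (hH : ¬ FiniteDimensional ℂ H)
    {F : (ι → ℝ) × ℝ → H →L[ℂ] H} {s : Finset ι} (hs : ∀ t ∈ simplex s, IsUnit (affineMap b t))
    (hF : ∀ i ∈ s, Contracts b F (s.erase i)) :
    ∃ G, Contracts b G s ∧ ∀ i ∈ s, Set.EqOn G F (simplex (s.erase i) ×ˢ Set.Icc 0 1) := by
  let f : (ι → ℝ) × ℝ → H →L[ℂ] H := fun y =>
    if y.2 = 0 then affineMap b y.1 else if y.2 = 1 then 1 else F y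
  let K₁ : Set ((ι → ℝ) × ℝ) := ⋃ i : s, simplex (s.erase i) ×ˢ Set.Icc 0 1
  have hclosed (s : Finset ι) : IsClosed (simplex s) := (isCompact_simplex s).isClosed
  have hface (i : s) : IsClosed (simplex (s.erase i) ×ˢ Set.Icc (0 : ℝ) 1) :=
    (hclosed _).prod isClosed_Icc
  have hfF : ∀ i ∈ s, Set.EqOn f F (simplex (s.erase i) ×ˢ Set.Icc 0 1) := by
    rintro i hi ⟨t, h⟩ ⟨ht, hh⟩
    by_cases h0 : h = 0
    · subst h0
      simp [f, (hF i hi).zero t ht]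
    by_cases h1 : h = 1
    · subst h1
      simp [f, (hF i hi).one t ht]
    simp [f, h0, h1]
  have hK₁ : IsClosed K₁ := isClosed_iUnion_of_finite hface
  have hb (c : ℝ) : IsClosed (simplex s ×ˢ ({c} : Set ℝ)) := (hclosed _).prod isClosed_singleton
  have hf0 : Set.EqOn f (fun y => affineMap b y.1) (simplex s ×ˢ {0}) := by
    rintro ⟨t, h⟩ ⟨ht, rfl : h = 0⟩
    simp [f]
  have hf1 : Set.EqOn f (fun _ => 1) (simplex s ×ˢ {1}) := by
    rintro ⟨t, h⟩ ⟨ht, rfl : h = 1⟩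
    simp [f]
  have hKD : K₁ ∪ (simplex s ×ˢ {0} ∪ simplex s ×ˢ {1}) ⊆ simplex s ×ˢ Set.Icc (0 : ℝ) 1 := by
    refine Set.union_subset (Set.iUnion_subset fun i => ?_) (Set.union_subset ?_ ?_)
    · exact Set.prod_mono_left (simplex_mono (Finset.erase_subset _ s))
    · exact Set.prod_mono_right (by simp)
    · exact Set.prod_mono_right (by simp)
  obtain ⟨G, hGc, hGf, hGu⟩ := exists_continuousOn_isUnit_eqOn hH
    ((isCompact_simplex s).prod isCompact_Icc) (hK₁.union ((hb 0).union (hb 1))) hKD (f := f) (by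
      refine ContinuousOn.union_of_isClosed ?_ (ContinuousOn.union_of_isClosed ?_ ?_ (hb 0) (hb 1))
        hK₁ ((hb 0).union (hb 1))
      · exact (locallyFinite_of_finite _).continuousOn_iUnion hface fun i =>
          (hF i i.2).continuousOn.congr (hfF i i.2)
      · exact ((continuousOn_affineMap b s).comp continuousOn_fst fun y hy => hy.1).congr hf0
      · exact continuousOn_const.congr hf1) (by
      rintro y (hy | hy | hy)
      · obtain ⟨i, hi⟩ := Set.mem_iUnion.1 hy
        rw [hfF i i.2 hi]
        exact (hF i i.2).isUnit y hi
      · rw [hf0 hy]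
        exact hs _ hy.1
      · rw [hf1 hy]
        exact isUnit_one)
  refine ⟨G, ⟨hGc, hGu, fun t ht => ?_, fun t ht => ?_⟩, fun i hi y hy => ?_⟩
  · have hy : (t, (0 : ℝ)) ∈ simplex s ×ˢ ({0} : Set ℝ) := ⟨ht, rfl⟩
    rw [hGf (.inr (.inl hy)), hf0 hy]
  · have hy : (t, (1 : ℝ)) ∈ simplex s ×ˢ ({1} : Set ℝ) := ⟨ht, rfl⟩
    rw [hGf (.inr (.inr hy)), hf1 hy]
  · rw [hGf (.inl (Set.mem_iUnion.2 ⟨⟨i, hi⟩, hy⟩))]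
    exact hfF i hi hy

open Classical in
theorem Contracts.exists_succ (hH : ¬ FiniteDimensional ℂ H) {n : ℕ}
    {F : (ι → ℝ) × ℝ → H →L[ℂ] H}
    (hF : ∀ s : Finset ι, (∀ t ∈ simplex s, IsUnit (affineMap b t)) → s.card ≤ n →
      Contracts b F s) :
    ∃ G, (∀ s : Finset ι, (∀ t ∈ simplex s, IsUnit (affineMap b t)) → s.card ≤ n + 1 →
      Contracts b G s) ∧ ∀ t h, (carrier t).card ≤ n → G (t, h) = F (t, h) := by
  have key (s : Finset ι) : ∃ G, (∀ t ∈ simplex s, IsUnit (affineMap b t)) → s.card = n + 1 →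
      Contracts b G s ∧ ∀ i ∈ s, Set.EqOn G F (simplex (s.erase i) ×ˢ Set.Icc 0 1) := by
    by_cases hs : (∀ t ∈ simplex s, IsUnit (affineMap b t)) ∧ s.card = n + 1
    · obtain ⟨G, hG⟩ := Contracts.exists_extend_boundary hH (F := F) hs.1 fun i hi => hF _
        (fun t ht => hs.1 t (simplex_mono (s.erase_subset i) ht))
        (by rw [Finset.card_erase_of_mem hi, hs.2]; rfl)
      exact ⟨G, fun _ _ => hG⟩
    · exact ⟨0, fun h1 h2 => (hs ⟨h1, h2⟩).elim⟩
  choose G hG using key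
  refine ⟨fun y => if (carrier y.1).card ≤ n then F y else G (carrier y.1) y, fun s hs hn => ?_,
    fun t h ht => if_pos ht⟩
  rcases hn.lt_or_eq with hn | hn
  · refine (hF s hs (Nat.lt_succ_iff.1 hn)).congr fun y hy => if_pos ?_
    exact (Finset.card_le_card (carrier_subset hy.1)).trans (Nat.lt_succ_iff.1 hn)
  · refine (hG s hs hn).1.congr fun y hy => ?_
    by_cases hc : carrier y.1 = s
    · simp [hc, hn]
    · have hss : carrier y.1 ⊂ s := (carrier_subset hy.1).ssubset_of_ne hc
      have hlt := Finset.card_lt_card hss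
      obtain ⟨i, hi, hic⟩ := Finset.exists_of_ssubset hss
      have hle : (carrier y.1).card ≤ n := by omega
      simp only [hle, if_true]
      refine ((hG s hs hn).2 i hi ⟨simplex_mono ?_ (mem_simplex_carrier hy.1), hy.2⟩).symm
      exact Finset.subset_erase.2 ⟨hss.1, hic⟩

theorem exists_forall_contracts (hH : ¬ FiniteDimensional ℂ H) (b : ι → H →L[ℂ] H) :
    ∃ F, ∀ s : Finset ι, (∀ t ∈ simplex s, IsUnit (affineMap b t)) → Contracts b F s := by
  let P (n : ℕ) := {F : (ι → ℝ) × ℝ → H →L[ℂ] H // ∀ s : Finset ι,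
    (∀ t ∈ simplex s, IsUnit (affineMap b t)) → s.card ≤ n → Contracts b F s}
  let base : P 0 := ⟨0, fun s _ hs => by
    have : simplex s = ∅ := by
      rw [Finset.card_eq_zero.1 (Nat.le_zero.1 hs)]
      exact Set.eq_empty_of_forall_notMem fun t ht => by simpa using ht.2.2
    constructor <;> simp [this]⟩
  have step (n : ℕ) (F : P n) : ∃ G : P (n + 1), ∀ t h, (carrier t).card ≤ n →
      G.1 (t, h) = F.1 (t, h) := by
    obtain ⟨G, hG, hGF⟩ := Contracts.exists_succ hH F.2
    exact ⟨⟨G, hG⟩, hGF⟩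
  choose succ hsucc using step
  let F (n : ℕ) : P n := Nat.rec base succ n
  have hF {m n : ℕ} (hmn : m ≤ n) (t : ι → ℝ) (h : ℝ) (hm : (carrier t).card ≤ m) :
      (F n).1 (t, h) = (F m).1 (t, h) := by
    induction n, hmn using Nat.le_induction with
    | base => rfl
    | succ n hmn ih => exact (hsucc n (F n) t h (hm.trans hmn)).trans ih
  refine ⟨fun y => (F (carrier y.1).card).1 y, fun s hs => ?_⟩
  refine ((F s.card).2 s hs le_rfl).congr fun y hy => ?_
  exact (hF (Finset.card_le_card (carrier_subset hy.1)) y.1 y.2 le_rfl).symm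

end Nerve

section Polar

theorem isUnit_of_dist_lt {A : Type*} [CStarAlgebra A] {x y : A} (hx : x ∈ unitary A)
    (h : dist y x < 1) : IsUnit y := by
  have h1 : ‖star x * (x - y)‖ < 1 := by
    rw [CStarRing.norm_mem_unitary_mul _ (Unitary.star_mem hx)]
    rwa [← dist_eq_norm, dist_comm]
  have h2 : y = x * (1 - star x * (x - y)) := by
    rw [mul_sub, ← mul_assoc, Unitary.mul_star_self_of_mem hx]
    simp
  rw [h2]
  exact (Unitary.toUnits ⟨x, hx⟩).isUnit.mul (Units.oneSub _ h1).isUnit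

variable {A : Type*} [CStarAlgebra A] [PartialOrder A] [StarOrderedRing A]

/-- The unitary part of an invertible element. -/
noncomputable def unitaryPart (a : A) : A := a * (star a * a) ^ (-(1 / 2) : ℝ)

theorem isStrictlyPositive_star_mul_self {a : A} (ha : IsUnit a) :
    IsStrictlyPositive (star a * a) :=
  (ha.star.mul ha).isStrictlyPositive (star_mul_self_nonneg a)

theorem unitaryPart_mem {a : A} (ha : IsUnit a) : unitaryPart a ∈ unitary A := by
  have hp := isStrictlyPositive_star_mul_self ha
  set p := star a * a with hpa
  set c := p ^ (-(1 / 2) : ℝ) with hc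
  have hcs : star c = c := by
    have : 0 ≤ c := CFC.rpow_nonneg
    exact (IsSelfAdjoint.of_nonneg this).star_eq
  have hcp : c * p * c = 1 := by
    have h1 : p ^ (1 : ℝ) = p := CFC.rpow_one p hp.nonneg
    rw [← h1, hc, ← CFC.rpow_add hp.isUnit, ← CFC.rpow_add hp.isUnit]
    norm_num
    exact CFC.rpow_zero p hp.nonneg
  have hcu : IsUnit c := hp.isUnit.cfcRpow _ hp.nonneg
  have h1 : star (a * c) * (a * c) = 1 := by
    rw [star_mul, hcs, ← hcp, hpa]
    noncomm_ring
  have h2 : a * c * star (a * c) = 1 :=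
    (ha.mul hcu).mul_right_cancel (by rw [mul_assoc, h1, mul_one, one_mul])
  exact Unitary.mem_iff.2 ⟨h1, h2⟩

theorem unitaryPart_of_mem {a : A} (ha : a ∈ unitary A) : unitaryPart a = a := by
  rw [unitaryPart, Unitary.star_mul_self_of_mem ha, CFC.one_rpow, mul_one]

theorem continuousOn_unitaryPart : ContinuousOn (unitaryPart : A → A) {a | IsUnit a} :=
  continuousOn_id.mul ((CFC.continuousOn_rpow _).comp (by fun_prop)
    fun _ ha => isStrictlyPositive_star_mul_self ha)

theorem homotopic_of_isUnit {f g : C(unitary A, unitary A)} (Φ : unitInterval × unitary A → A)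
    (hΦ : Continuous Φ) (hu : ∀ y, IsUnit (Φ y)) (h0 : ∀ x, unitaryPart (Φ (0, x)) = f x)
    (h1 : ∀ x, unitaryPart (Φ (1, x)) = g x) : f.Homotopic g :=
  ⟨{ toFun := fun y => ⟨unitaryPart (Φ y), unitaryPart_mem (hu y)⟩
     continuous_toFun := (continuousOn_unitaryPart.comp_continuous hΦ hu).subtype_mk _
     map_zero_left := fun x => Subtype.ext (h0 x)
     map_one_left := fun x => Subtype.ext (h1 x) }⟩

end Polar

end Kuiper

open Kuiper in
/-- Kuiper's theorem: the unitary group of an infinite-dimensional separable complex Hilbert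
space, with the operator-norm topology, is contractible. -/
theorem unitary_group_contractible
    {H : Type*} [NormedAddCommGroup H] [InnerProductSpace ℂ H] [CompleteSpace H]
    [TopologicalSpace.SeparableSpace H] (hH : ¬ FiniteDimensional ℂ H) :
    ContractibleSpace (unitary (H →L[ℂ] H)) := by
  rw [contractible_iff_id_nullhomotopic]
  obtain ⟨φ, hφ⟩ := PartitionOfUnity.exists_isSubordinate (X := unitary (H →L[ℂ] H))
    isClosed_univ (fun x => Metric.ball x (1 / 2)) (fun x => Metric.isOpen_ball)
    fun x _ => Set.mem_iUnion.2 ⟨x, by simp⟩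
  let b (x : unitary (H →L[ℂ] H)) : H →L[ℂ] H := x
  let Φ (x : unitary (H →L[ℂ] H)) (i : unitary (H →L[ℂ] H)) : ℝ := φ i x
  have hsimp (x) : Φ x ∈ simplex (φ.finsupport x) :=
    ⟨fun i => φ.nonneg i x, fun i hi => by simpa using hi, φ.sum_finsupport (Set.mem_univ x)⟩
  have hball (x) (t) (ht : t ∈ simplex (φ.fintsupport x)) :
      affineMap b t ∈ Metric.ball (x : H →L[ℂ] H) 1 := by
    rw [affineMap_eq_sum b ht]
    refine (convex_ball _ _).sum_mem (fun i _ => ht.1 i) ht.2.2 fun i hi => ?_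
    have := hφ i ((φ.mem_fintsupport_iff x i).1 hi)
    rw [Metric.mem_ball_comm]
    exact Metric.ball_subset_ball (by norm_num) this
  have hgood (x) (t) (ht : t ∈ simplex (φ.fintsupport x)) : IsUnit (affineMap b t) :=
    isUnit_of_dist_lt x.2 (hball x t ht)
  have hsimp' (x) : Φ x ∈ simplex (φ.fintsupport x) :=
    simplex_mono (φ.finsupport_subset_fintsupport x) (hsimp x)
  obtain ⟨F, hF⟩ := exists_forall_contracts hH b
  have hF' (x) := hF (φ.fintsupport x) (hgood x)
  have hΦ : Continuous Φ := continuous_pi fun i => (φ i).continuous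
  have hcont : Continuous fun y : unitInterval × unitary (H →L[ℂ] H) => F (Φ y.2, y.1) := by
    refine continuous_iff_continuousAt.2 fun ⟨h, x⟩ => ?_
    have hN : ∀ᶠ y : unitInterval × unitary (H →L[ℂ] H) in nhds (h, x),
        (Φ y.2, (y.1 : ℝ)) ∈ simplex (φ.fintsupport x) ×ˢ Set.Icc (0 : ℝ) 1 := by
      filter_upwards [continuousAt_snd.eventually (φ.eventually_finsupport_subset x)] with y hy
      exact ⟨simplex_mono hy (hsimp _), y.1.2⟩
    exact ((hF' x).continuousOn.continuousWithinAt hN.self_of_nhds).tendsto.comp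
      (tendsto_nhdsWithin_iff.2 ⟨Continuous.tendsto (by fun_prop) _, hN⟩)
  have hunit (y : unitInterval × unitary (H →L[ℂ] H)) : IsUnit (F (Φ y.2, y.1)) :=
    (hF' y.2).isUnit _ ⟨hsimp' y.2, y.1.2⟩
  have hmid (x) : F (Φ x, 0) = affineMap b (Φ x) := (hF' x).zero _ (hsimp' x)
  have hmidc : Continuous fun x => affineMap b (Φ x) := by
    simp_rw [← hmid]
    exact hcont.comp (by fun_prop : Continuous fun x => ((0 : unitInterval), x))
  let m : C(unitary (H →L[ℂ] H), unitary (H →L[ℂ] H)) :=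
    ⟨fun x => ⟨unitaryPart (affineMap b (Φ x)), unitaryPart_mem (hgood x _ (hsimp' x))⟩,
      (continuousOn_unitaryPart.comp_continuous hmidc fun x => hgood x _ (hsimp' x)).subtype_mk _⟩
  refine ⟨1, ContinuousMap.Homotopic.trans (g := m) ?_ ?_⟩
  · refine homotopic_of_isUnit (fun y => AffineMap.lineMap (y.2 : H →L[ℂ] H) (affineMap b (Φ y.2))
      (y.1 : ℝ)) ?_ ?_ ?_ ?_
    · simp only [AffineMap.lineMap_apply_module]
      have := hmidc.comp (continuous_snd : Continuous
        (Prod.snd : unitInterval × unitary (H →L[ℂ] H) → _))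
      fun_prop
    · intro y
      refine isUnit_of_dist_lt y.2.2 ?_
      exact (convex_ball (y.2 : H →L[ℂ] H) 1).lineMap_mem (Metric.mem_ball_self one_pos)
        (hball _ _ (hsimp' _)) y.1.2
    · intro x
      simp [unitaryPart_of_mem x.2]
    · intro x
      simp [m]
  · refine homotopic_of_isUnit (fun y => F (Φ y.2, y.1)) hcont hunit (fun x => ?_) fun x => ?_
    · simp [m, hmid]
    · have := (hF' x).one _ (hsimp' x)
      simp [this, unitaryPart_of_mem (one_mem _)]
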